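/- arXiv:2211.03698 — 2 statements merged into one kernel-verified Lean document; each statement's English description precedes it below -/
import Mathlib

section
/- Let A ∈ ℝ^{n_x×n_x}, C ∈ ℝ^{n_y×n_x}, D ∈ ℝ^{n_s×n_x} with D of full row rank, K ≥ 2, and let Σ₁, Σᵗ ∈ ℝ^{n_x×n_x} and Σʷ ∈ ℝ^{n_y×n_y} be symmetric positive definite, and Σᵛ_K ∈ ℝ^{K n_y × K n_y} symmetric positive semidefinite. Define F_K ∈ ℝ^{K n_x × n_x} as the block column matrix whose i-th block is A^{i−1} (i = 1,…,K), J_K ∈ ℝ^{K n_x × (K−1) n_x} as the block lower-triangular matrix whose (i,j) block is A^{i−j−1} for i > j and 0 otherwise, Q := F_K Σ₁ F_Kᵀ + J_K (I_{K−1} ⊗ Σᵗ) J_Kᵀ, C̃_K := I_K ⊗ C, and D̃_K := I_K ⊗ D. Then the block matrix [[C̃_K Q C̃_Kᵀ + I_K ⊗ Σʷ + Σᵛ_K, C̃_K Q D̃_Kᵀ], [D̃_K Q C̃_Kᵀ, D̃_K Q D̃_Kᵀ]] is symmetric positive definite. -/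
open Matrix MeasureTheory
open scoped Kronecker

/-- A block diagonal matrix with positive definite blocks is positive definite. -/
theorem Matrix.PosDef.fromBlocks_zero_zero {m n : Type*} [Fintype m] [Fintype n]
    {M : Matrix m m ℝ} {N : Matrix n n ℝ} (hM : M.PosDef) (hN : N.PosDef) :
    (fromBlocks M 0 0 N).PosDef := by
  refine .of_dotProduct_mulVec_pos (hM.1.fromBlocks (by simp) hN.1) fun x hx => ?_
  obtain ⟨u, v, rfl⟩ : ∃ u v, x = Sum.elim u v := ⟨x ∘ Sum.inl, x ∘ Sum.inr, by simp⟩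
  have key : star (Sum.elim u v) ⬝ᵥ fromBlocks M 0 0 N *ᵥ Sum.elim u v =
      star u ⬝ᵥ M *ᵥ u + star v ⬝ᵥ N *ᵥ v := by
    simp [fromBlocks_mulVec, Function.comp_def, dotProduct]
  rw [key]
  by_cases hu : u = 0
  · have hv : v ≠ 0 := by
      rintro rfl
      exact hx (by simp [hu])
    exact add_pos_of_nonneg_of_pos (hM.posSemidef.dotProduct_mulVec_nonneg u)
      (hN.dotProduct_mulVec_pos hv)
  · exact add_pos_of_pos_of_nonneg (hM.dotProduct_mulVec_pos hu)
      (hN.posSemidef.dotProduct_mulVec_nonneg v)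

/-- The rows of a matrix with a right inverse are linearly independent. -/
theorem Matrix.vecMul_injective_of_mul_eq_one {m n : Type*} [Fintype m] [Fintype n]
    [DecidableEq m] {M : Matrix m n ℝ} {R : Matrix n m ℝ} (h : M * R = 1) :
    Function.Injective M.vecMul :=
  Function.LeftInverse.injective (g := R.vecMul) fun x => by simp [vecMul_vecMul, h]

/-- The block columns of powers of `A` jointly have linearly independent rows: they form a
block unitriangular matrix. -/
theorem vecMul_fromCols_pow_injective {n K : ℕ} (A : Matrix (Fin n) (Fin n) ℝ)
    (F : Matrix (Fin K × Fin n) (Fin n) ℝ)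
    (hF : ∀ (i : Fin K) (r s : Fin n), F (i, r) s = (A ^ (i : ℕ)) r s)
    (J : Matrix (Fin K × Fin n) (Fin (K - 1) × Fin n) ℝ)
    (hJ : ∀ (i : Fin K) (r : Fin n) (j : Fin (K - 1)) (s : Fin n),
      J (i, r) (j, s) = if (j : ℕ) < (i : ℕ) then (A ^ ((i : ℕ) - (j : ℕ) - 1)) r s else 0) :
    Function.Injective (fromCols F J).vecMul := by
  refine (injective_iff_map_eq_zero (vecMulLinear (fromCols F J))).2 fun x hx => ?_
  replace hx : x ᵥ* fromCols F J = 0 := hx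
  let G (m : ℕ) : Matrix (Fin K × Fin n) (Fin n) ℝ :=
    of fun p s => if m ≤ (p.1 : ℕ) then (A ^ ((p.1 : ℕ) - m)) p.2 s else 0
  have hG (m : ℕ) : x ᵥ* G m = 0 := by
    ext s
    rcases m with _ | l
    · have h := congrFun hx (Sum.inl s)
      simpa [G, vecMul, dotProduct, hF, Fintype.sum_prod_type] using h
    · by_cases hl : l < K - 1
      · have h := congrFun hx (Sum.inr (⟨l, hl⟩, s))
        simpa [G, vecMul, dotProduct, hJ, Fintype.sum_prod_type, Nat.sub_sub,
          Nat.succ_le_iff] using h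
      · refine Finset.sum_eq_zero fun p _ => ?_
        have : ¬ l + 1 ≤ (p.1 : ℕ) := by have := p.1.2; omega
        simp [G, this]
  ext ⟨j, s⟩
  have hcol (p : Fin K × Fin n) :
      (G j - G (j + 1) * A) p s = (1 : Matrix (Fin K × Fin n) (Fin K × Fin n) ℝ) p (j, s) := by
    obtain ⟨i, r⟩ := p
    rw [Matrix.sub_apply, mul_apply]
    rcases lt_trichotomy (i : ℕ) j with h | h | h
    · have hij : i ≠ j := fun e => by simp [e] at h
      simp [G, h.not_ge, (Nat.lt_succ_of_lt h).not_ge, one_apply, hij]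
    · obtain rfl := Fin.ext h
      simp [G, one_apply]
    · have hij : i ≠ j := fun e => by simp [e] at h
      have hp : (i : ℕ) - j = (i - (j + 1)) + 1 := by omega
      simp only [G, of_apply, h.le, Nat.succ_le_of_lt h, if_true, hp, pow_succ, mul_apply]
      simp [one_apply, hij]
  calc x (j, s) = (x ᵥ* (1 : Matrix (Fin K × Fin n) (Fin K × Fin n) ℝ)) (j, s) := by simp
    _ = (x ᵥ* (G j - G (j + 1) * A)) s := by simp only [vecMul, dotProduct, hcol]
    _ = 0 := by simp [vecMul_sub, ← vecMul_vecMul, hG]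

/-- With `F_K` the block column of powers of `A`, `J_K` the block
lower-triangular matrix of powers of `A`, `Q := F_K Σ₁ F_Kᵀ + J_K (I_{K-1} ⊗ Σᵗ) J_Kᵀ`,
`C̃_K := I_K ⊗ C` and `D̃_K := I_K ⊗ D` (`D` full row rank), and positive definite
`Σ₁, Σᵗ, Σʷ` and positive semidefinite `Σᵛ_K`, the joint covariance block matrix
`[[C̃_K Q C̃_Kᵀ + I_K ⊗ Σʷ + Σᵛ_K, C̃_K Q D̃_Kᵀ], [D̃_K Q C̃_Kᵀ, D̃_K Q D̃_Kᵀ]]`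
is symmetric positive definite. -/
theorem stmt2 (nx ny ns K : ℕ) (hK : 2 ≤ K)
    (A : Matrix (Fin nx) (Fin nx) ℝ)
    (C : Matrix (Fin ny) (Fin nx) ℝ) (D : Matrix (Fin ns) (Fin nx) ℝ)
    (hD : Function.Surjective D.mulVecLin)
    (S1 St : Matrix (Fin nx) (Fin nx) ℝ) (hS1 : S1.PosDef) (hSt : St.PosDef)
    (Sw : Matrix (Fin ny) (Fin ny) ℝ) (hSw : Sw.PosDef)
    (Sv : Matrix (Fin K × Fin ny) (Fin K × Fin ny) ℝ) (hSv : Sv.PosSemidef)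
    (F : Matrix (Fin K × Fin nx) (Fin nx) ℝ)
    (hF : ∀ (i : Fin K) (r s : Fin nx), F (i, r) s = (A ^ (i : ℕ)) r s)
    (J : Matrix (Fin K × Fin nx) (Fin (K - 1) × Fin nx) ℝ)
    (hJ : ∀ (i : Fin K) (r : Fin nx) (j : Fin (K - 1)) (s : Fin nx),
      J (i, r) (j, s) = if (j : ℕ) < (i : ℕ) then (A ^ ((i : ℕ) - (j : ℕ) - 1)) r s else 0)
    (Q : Matrix (Fin K × Fin nx) (Fin K × Fin nx) ℝ)
    (hQ : Q = F * S1 * Fᵀ + J * ((1 : Matrix (Fin (K - 1)) (Fin (K - 1)) ℝ) ⊗ₖ St) * Jᵀ) :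
    (Matrix.fromBlocks
      (((1 : Matrix (Fin K) (Fin K) ℝ) ⊗ₖ C) * Q * ((1 : Matrix (Fin K) (Fin K) ℝ) ⊗ₖ C)ᵀ +
        (1 : Matrix (Fin K) (Fin K) ℝ) ⊗ₖ Sw + Sv)
      (((1 : Matrix (Fin K) (Fin K) ℝ) ⊗ₖ C) * Q * ((1 : Matrix (Fin K) (Fin K) ℝ) ⊗ₖ D)ᵀ)
      (((1 : Matrix (Fin K) (Fin K) ℝ) ⊗ₖ D) * Q * ((1 : Matrix (Fin K) (Fin K) ℝ) ⊗ₖ C)ᵀ)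
      (((1 : Matrix (Fin K) (Fin K) ℝ) ⊗ₖ D) * Q *
        ((1 : Matrix (Fin K) (Fin K) ℝ) ⊗ₖ D)ᵀ)).PosDef := by
  have hT : ((1 : Matrix (Fin (K - 1)) (Fin (K - 1)) ℝ) ⊗ₖ St).PosDef := .kronecker .one hSt
  have hQpos : Q.PosDef := by
    have h := (hS1.fromBlocks_zero_zero hT).mul_mul_conjTranspose_same
      (vecMul_fromCols_pow_injective A F hF J hJ)
    convert h using 1
    rw [hQ, conjTranspose_eq_transpose_of_trivial, transpose_fromCols,
      fromCols_mul_fromBlocks, fromCols_mul_fromRows]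
    simp
  have hW : ((1 : Matrix (Fin K) (Fin K) ℝ) ⊗ₖ Sw + Sv).PosDef :=
    (PosDef.kronecker .one hSw).add_posSemidef hSv
  obtain ⟨R, hR⟩ := mulVec_surjective_iff_exists_right_inverse.1 hD
  have hDR : ((1 : Matrix (Fin K) (Fin K) ℝ) ⊗ₖ D) * ((1 : Matrix (Fin K) (Fin K) ℝ) ⊗ₖ R) =
      1 := by
    rw [← mul_kronecker_mul, hR, one_mul, one_kronecker_one]
  generalize (1 : Matrix (Fin K) (Fin K) ℝ) ⊗ₖ D = D' at *
  generalize (1 : Matrix (Fin K) (Fin K) ℝ) ⊗ₖ R = R' at *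
  generalize (1 : Matrix (Fin K) (Fin K) ℝ) ⊗ₖ C = C'
  have hL : fromBlocks (1 : Matrix (Fin K × Fin ny) (Fin K × Fin ny) ℝ) C' 0 D' *
      fromBlocks (1 : Matrix (Fin K × Fin ny) (Fin K × Fin ny) ℝ) (-(C' * R')) 0 R' = 1 := by
    simp [fromBlocks_multiply, hDR, fromBlocks_one]
  have h := (hW.fromBlocks_zero_zero hQpos).mul_mul_conjTranspose_same
    (vecMul_injective_of_mul_eq_one hL)
  convert h using 1
  simp [fromBlocks_multiply, conjTranspose_eq_transpose_of_trivial, fromBlocks_transpose,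
    add_comm, add_left_comm]
end

section
/- Let n = n₁ + n₂ and let f be a log-concave probability density on ℝⁿ = ℝ^{n₁} × ℝ^{n₂} with marginal densities f₁ on ℝ^{n₁} and f₂ on ℝ^{n₂}. Assume the differential entropies h[f], h[f₁], h[f₂] are finite and the essential suprema ‖f‖_∞, ‖f₁‖_∞, ‖f₂‖_∞ are finite and positive. Then the mutual information satisfies h[f₁] + h[f₂] − h[f] ≤ log(‖f‖_∞ / (‖f₁‖_∞ · ‖f₂‖_∞)) + n. -/
open Matrix MeasureTheory

open scoped ENNReal Pointwise

theorem ENNReal.rpow_mul_rpow_le_ofReal_mul_add {a b : ℝ} (ha : 0 < a) (hb : 0 < b)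
    (hab : a + b = 1) (x y : ℝ≥0∞) :
    x ^ a * y ^ b ≤ ENNReal.ofReal a * x + ENNReal.ofReal b * y := by
  have ha' : ENNReal.ofReal a ≠ 0 := by simpa using ha
  have hb' : ENNReal.ofReal b ≠ 0 := by simpa using hb
  induction x with
  | top => simp [ENNReal.mul_top ha']
  | coe x =>
    induction y with
    | top => simp [ENNReal.mul_top hb']
    | coe y =>
      have h := NNReal.geom_mean_le_arith_mean2_weighted a.toNNReal b.toNNReal x y
        (by rw [← Real.toNNReal_add ha.le hb.le, hab, Real.toNNReal_one])
      rw [Real.coe_toNNReal a ha.le, Real.coe_toNNReal b hb.le] at h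
      rw [← ENNReal.coe_rpow_of_nonneg _ ha.le, ← ENNReal.coe_rpow_of_nonneg _ hb.le,
        ENNReal.ofReal, ENNReal.ofReal]
      exact_mod_cast h

theorem IsCompact.volume_add_le_volume_add {K L : Set ℝ} (hK : IsCompact K) (hL : IsCompact L)
    (hK₀ : K.Nonempty) (hL₀ : L.Nonempty) : volume K + volume L ≤ volume (K + L) := by
  obtain ⟨p, hp, hpK⟩ := hK.exists_isGreatest hK₀
  obtain ⟨q, hq, hqL⟩ := hL.exists_isLeast hL₀
  have hsub : (fun x => x + q) '' K ∪ (fun y => p + y) '' L ⊆ K + L := by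
    rintro _ (⟨x, hx, rfl⟩ | ⟨y, hy, rfl⟩)
    · exact Set.add_mem_add hx hq
    · exact Set.add_mem_add hp hy
  have hdisj : AEDisjoint volume ((fun x => x + q) '' K) ((fun y => p + y) '' L) := by
    refine measure_mono_null (t := {p + q}) ?_ Real.volume_singleton
    rintro _ ⟨⟨x, hx, rfl⟩, ⟨y, hy, hxy⟩⟩
    have h₁ := hpK hx
    have h₂ := hqL hy
    simp only [Set.mem_singleton_iff] at hxy ⊢
    linarith
  refine le_trans (le_of_eq ?_) (measure_mono hsub)
  rw [measure_union₀ (hL.image (by fun_prop)).measurableSet.nullMeasurableSet hdisj]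
  simp [Set.image_add_left, Set.image_add_right, measure_preimage_add, measure_preimage_add_right]

theorem MeasurableSet.volume_add_le_volume_add {A B : Set ℝ} (hA : MeasurableSet A)
    (hB : MeasurableSet B) (hA₀ : A.Nonempty) (hB₀ : B.Nonempty) :
    volume A + volume B ≤ volume (A + B) := by
  obtain ⟨p, hp⟩ := hA₀
  obtain ⟨q, hq⟩ := hB₀
  rw [hA.measure_eq_iSup_isCompact, hB.measure_eq_iSup_isCompact]
  simp only [iSup_and']
  refine ENNReal.biSup_add_biSup_le' (p := fun K => K ⊆ A ∧ IsCompact K)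
    (q := fun K => K ⊆ B ∧ IsCompact K) ⟨∅, by simp⟩ ⟨∅, by simp⟩ ?_
  rintro K ⟨hKA, hK⟩ L ⟨hLB, hL⟩
  calc volume K + volume L ≤ volume (insert p K) + volume (insert q L) := by
        gcongr <;> exact Set.subset_insert _ _
    _ ≤ volume (insert p K + insert q L) :=
        (hK.insert p).volume_add_le_volume_add (hL.insert q) (Set.insert_nonempty _ _)
          (Set.insert_nonempty _ _)
    _ ≤ volume (A + B) :=
        measure_mono (Set.add_subset_add (Set.insert_subset hp hKA) (Set.insert_subset hq hLB))

theorem prekopaLeindler_real_of_le_one {a b : ℝ} (ha : 0 < a) (hb : 0 < b) (hab : a + b = 1)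
    {f g h : ℝ → ℝ} (hf : Measurable f) (hg : Measurable g) (hh : Measurable h)
    (hf₀ : ∀ x, 0 ≤ f x) (hg₀ : ∀ x, 0 ≤ g x) (hh₀ : ∀ x, 0 ≤ h x)
    (hf₁ : ∀ x, f x ≤ 1) (hg₁ : ∀ x, g x ≤ 1)
    (hfs : ∀ t < 1, ∃ x, t < f x) (hgs : ∀ t < 1, ∃ x, t < g x)
    (hle : ∀ x y, f x ^ a * g y ^ b ≤ h (a * x + b * y)) :
    ENNReal.ofReal a * (∫⁻ x, ENNReal.ofReal (f x)) + ENNReal.ofReal b *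
      (∫⁻ x, ENNReal.ofReal (g x)) ≤ ∫⁻ x, ENNReal.ofReal (h x) := by
  rw [lintegral_eq_lintegral_meas_lt _ (.of_forall hf₀) hf.aemeasurable,
    lintegral_eq_lintegral_meas_lt _ (.of_forall hg₀) hg.aemeasurable,
    lintegral_eq_lintegral_meas_lt _ (.of_forall hh₀) hh.aemeasurable,
    ← lintegral_const_mul' _ _ ENNReal.ofReal_ne_top,
    ← lintegral_const_mul' _ _ ENNReal.ofReal_ne_top]
  refine (le_lintegral_add _ _).trans (setLIntegral_mono' measurableSet_Ioi fun t ht => ?_)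
  rw [Set.mem_Ioi] at ht
  rcases le_or_gt 1 t with h1 | h1
  · have e₁ : {x | t < f x} = ∅ := Set.eq_empty_of_forall_notMem fun x hx =>
      absurd ((Set.mem_ofPred.1 hx).trans_le (hf₁ x)) h1.not_gt
    have e₂ : {x | t < g x} = ∅ := Set.eq_empty_of_forall_notMem fun x hx =>
      absurd ((Set.mem_ofPred.1 hx).trans_le (hg₁ x)) h1.not_gt
    simp [e₁, e₂]
  have hsub : a • {x | t < f x} + b • {x | t < g x} ⊆ {x | t < h x} := by
    rintro _ ⟨_, ⟨x, hx, rfl⟩, _, ⟨y, hy, rfl⟩, rfl⟩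
    rw [Set.mem_ofPred] at hx hy
    refine lt_of_lt_of_le ?_ (hle x y)
    calc t = t ^ a * t ^ b := by rw [← Real.rpow_add ht, hab, Real.rpow_one]
      _ < f x ^ a * g y ^ b := mul_lt_mul'' (Real.rpow_lt_rpow ht.le hx ha)
          (Real.rpow_lt_rpow ht.le hy hb) (by positivity) (by positivity)
  calc _ = volume (a • {x | t < f x}) + volume (b • {x | t < g x}) := by
        simp [abs_of_pos, ha, hb]
    _ ≤ volume (a • {x | t < f x} + b • {x | t < g x}) :=
        MeasurableSet.volume_add_le_volume_add
          ((measurableSet_lt measurable_const hf).const_smul₀ a)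
          ((measurableSet_lt measurable_const hg).const_smul₀ b)
          (Set.Nonempty.smul_set (hfs t h1)) (Set.Nonempty.smul_set (hgs t h1))
    _ ≤ _ := measure_mono hsub

theorem prekopaLeindler_real_of_iSup_ne_top {a b : ℝ} (ha : 0 < a) (hb : 0 < b) (hab : a + b = 1)
    {F G H : ℝ → ℝ≥0∞} (hF : Measurable F) (hG : Measurable G) (hH : Measurable H)
    (hF_top : ⨆ x, F x ≠ ∞) (hG_top : ⨆ x, G x ≠ ∞)
    (hle : ∀ x y, F x ^ a * G y ^ b ≤ H (a * x + b * y)) :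
    (∫⁻ x, F x) ^ a * (∫⁻ x, G x) ^ b ≤ ∫⁻ x, H x := by
  set A := ⨆ x, F x with hA
  set B := ⨆ x, G x with hB
  rcases eq_or_ne A 0 with hA₀ | hA₀
  · have : ∀ x, F x = 0 := by simpa [hA] using hA₀
    simp [this, ha]
  rcases eq_or_ne B 0 with hB₀ | hB₀
  · have : ∀ x, G x = 0 := by simpa [hB] using hB₀
    simp [this, hb]
  have hF_le (x) : F x / A ≤ 1 := ENNReal.div_le_of_le_mul (by simpa using le_iSup F x)
  have hG_le (x) : G x / B ≤ 1 := ENNReal.div_le_of_le_mul (by simpa using le_iSup G x)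
  set C := A ^ a * B ^ b with hC
  have hC₀ : C ≠ 0 := by simp [hC, hA₀, hB₀, hF_top, hG_top]
  have hC_top : C ≠ ∞ :=
    ENNReal.mul_ne_top (ENNReal.rpow_ne_top_of_nonneg ha.le hF_top)
      (ENNReal.rpow_ne_top_of_nonneg hb.le hG_top)
  have hCinv : C⁻¹ = A⁻¹ ^ a * B⁻¹ ^ b := by
    rw [hC, ENNReal.mul_inv (by simp [hA₀, hF_top]) (by simp [hB₀, hG_top]), ENNReal.inv_rpow,
      ENNReal.inv_rpow]
  have exists_lt {K : ℝ → ℝ≥0∞} (hK₀ : ⨆ x, K x ≠ 0) (hK_top : ⨆ x, K x ≠ ∞)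
      (hK : ∀ x, K x / (⨆ x, K x) ≤ 1) (t : ℝ) (ht : t < 1) :
      ∃ x, t < (K x / ⨆ x, K x).toReal := by
    have h1 : ENNReal.ofReal t * (⨆ x, K x) < ⨆ x, K x := by
      conv_rhs => rw [← one_mul (⨆ x, K x)]
      exact (ENNReal.mul_lt_mul_iff_left hK₀ hK_top).2 (by simpa using ht)
    obtain ⟨x, hx⟩ := lt_iSup_iff.1 h1
    refine ⟨x, ?_⟩
    have h2 : ENNReal.ofReal t < K x / ⨆ x, K x :=
      (ENNReal.lt_div_iff_mul_lt (.inl hK₀) (.inl hK_top)).2 hx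
    have h3 := (hK x).trans_lt ENNReal.one_lt_top
    rcases lt_or_ge t 0 with ht₀ | ht₀
    · exact ht₀.trans_le ENNReal.toReal_nonneg
    · exact (ENNReal.ofReal_lt_iff_lt_toReal ht₀ h3.ne).1 h2
  have key := prekopaLeindler_real_of_le_one ha hb hab
    (f := fun x => (F x / A).toReal) (g := fun x => (G x / B).toReal)
    (h := fun x => (min 1 (H x / C)).toReal) (hF.div_const _).ennreal_toReal
    (hG.div_const _).ennreal_toReal (measurable_const.min (hH.div_const _)).ennreal_toReal
    (fun _ => ENNReal.toReal_nonneg) (fun _ => ENNReal.toReal_nonneg)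
    (fun _ => ENNReal.toReal_nonneg) (fun x => ENNReal.toReal_le_of_le_ofReal one_pos.le
      (by simpa using hF_le x)) (fun x => ENNReal.toReal_le_of_le_ofReal one_pos.le
      (by simpa using hG_le x)) (exists_lt hA₀ hF_top hF_le) (exists_lt hB₀ hG_top hG_le) (by
        intro x y
        rw [ENNReal.toReal_rpow, ENNReal.toReal_rpow, ← ENNReal.toReal_mul]
        refine ENNReal.toReal_mono (by simp) (le_min ?_ ?_)
        · exact mul_le_one' (ENNReal.rpow_le_one (hF_le x) ha.le)
            (ENNReal.rpow_le_one (hG_le y) hb.le)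
        · rw [div_eq_mul_inv, div_eq_mul_inv, div_eq_mul_inv, hCinv,
            ENNReal.mul_rpow_of_nonneg _ _ ha.le, ENNReal.mul_rpow_of_nonneg _ _ hb.le,
            mul_mul_mul_comm]
          gcongr
          exact hle x y)
  simp_rw [ENNReal.ofReal_toReal ((hF_le _).trans_lt ENNReal.one_lt_top).ne,
    ENNReal.ofReal_toReal ((hG_le _).trans_lt ENNReal.one_lt_top).ne,
    ENNReal.ofReal_toReal ((min_le_left 1 _).trans_lt ENNReal.one_lt_top).ne] at key
  have h1 := (ENNReal.rpow_mul_rpow_le_ofReal_mul_add ha hb hab _ _).trans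
    (key.trans (lintegral_mono fun x => min_le_right _ _))
  simp_rw [div_eq_mul_inv] at h1
  rw [lintegral_mul_const _ hF, lintegral_mul_const _ hG, lintegral_mul_const _ hH,
    ENNReal.mul_rpow_of_nonneg _ _ ha.le, ENNReal.mul_rpow_of_nonneg _ _ hb.le,
    mul_mul_mul_comm, ← hCinv] at h1
  exact (ENNReal.mul_le_mul_iff_left (by simpa using hC_top) (by simpa using hC₀)).1 h1

/-- The Prékopa–Leindler inequality on the real line. -/
theorem prekopaLeindler_real {a b : ℝ} (ha : 0 < a) (hb : 0 < b) (hab : a + b = 1)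
    {F G H : ℝ → ℝ≥0∞} (hF : Measurable F) (hG : Measurable G) (hH : Measurable H)
    (hle : ∀ x y, F x ^ a * G y ^ b ≤ H (a * x + b * y)) :
    (∫⁻ x, F x) ^ a * (∫⁻ x, G x) ^ b ≤ ∫⁻ x, H x := by
  have iSup_lintegral_trunc {K : ℝ → ℝ≥0∞} (hK : Measurable K) :
      ⨆ n : ℕ, ∫⁻ x, min (K x) n = ∫⁻ x, K x := by
    rw [← lintegral_iSup (fun n => hK.min measurable_const)
      (fun m n hmn x => min_le_min le_rfl (by exact_mod_cast hmn))]
    simp_rw [← inf_iSup_eq, ENNReal.iSup_natCast, inf_top_eq]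
  have iSup_rpow (u : ℕ → ℝ≥0∞) {c : ℝ} (hc : 0 < c) : (⨆ n, u n) ^ c = ⨆ n, u n ^ c :=
    (ENNReal.orderIsoRpow c hc).map_iSup u
  have trunc_ne_top (K : ℝ → ℝ≥0∞) (n : ℕ) : ⨆ x, min (K x) n ≠ ∞ :=
    ((iSup_le fun x => min_le_right _ _).trans_lt (ENNReal.natCast_lt_top n)).ne
  rw [← iSup_lintegral_trunc hF, ← iSup_lintegral_trunc hG, iSup_rpow _ ha, iSup_rpow _ hb,
    ENNReal.iSup_mul]
  refine iSup_le fun m => ?_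
  rw [ENNReal.mul_iSup]
  refine iSup_le fun n => ?_
  refine prekopaLeindler_real_of_iSup_ne_top ha hb hab (hF.min measurable_const)
    (hG.min measurable_const) hH (trunc_ne_top F m) (trunc_ne_top G n) fun x y =>
    le_trans ?_ (hle x y)
  gcongr <;> exact min_le_left _ _

/-- The Prékopa–Leindler inequality on `ℝⁿ`. -/
theorem prekopaLeindler {a b : ℝ} (ha : 0 < a) (hb : 0 < b) (hab : a + b = 1) {n : ℕ}
    {F G H : (Fin n → ℝ) → ℝ≥0∞} (hF : Measurable F) (hG : Measurable G) (hH : Measurable H)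
    (hle : ∀ x y, F x ^ a * G y ^ b ≤ H (a • x + b • y)) :
    (∫⁻ x, F x) ^ a * (∫⁻ x, G x) ^ b ≤ ∫⁻ x, H x := by
  induction n with
  | zero =>
    have huniv : (volume : Measure (Fin 0 → ℝ)) Set.univ = 1 := by
      simp [volume_pi, Measure.pi_of_empty _ default]
    simp only [lintegral_unique, huniv, mul_one]
    exact (hle _ _).trans_eq (congrArg H (Subsingleton.elim _ _))
  | succ n ih =>
    have cons_meas :
        Measurable fun p : ℝ × (Fin n → ℝ) => (Fin.cons p.1 p.2 : Fin (n + 1) → ℝ) := by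
      refine measurable_pi_iff.2 (Fin.cases ?_ fun j => ?_)
      · simpa using measurable_fst
      · simpa [Function.comp_def] using (measurable_pi_apply j).comp measurable_snd
    have fubini {K : (Fin (n + 1) → ℝ) → ℝ≥0∞} (hK : Measurable K) :
        ∫⁻ x, K x = ∫⁻ t : ℝ, ∫⁻ x : Fin n → ℝ, K (Fin.cons t x) := by
      refine Eq.trans ?_ (lintegral_prod _ (hK.comp cons_meas).aemeasurable)
      rw [← (volume_preserving_piFinSuccAbove (fun _ : Fin (n + 1) => ℝ) 0).symm.lintegral_comp hK]
      simp [MeasurableEquiv.piFinSuccAbove, Fin.insertNthEquiv, Measure.volume_eq_prod]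
    rw [fubini hF, fubini hG, fubini hH]
    refine prekopaLeindler_real ha hb hab (hF.comp cons_meas).lintegral_prod_right'
      (hG.comp cons_meas).lintegral_prod_right' (hH.comp cons_meas).lintegral_prod_right'
      fun s t => ?_
    refine ih ((hF.comp cons_meas).comp measurable_prodMk_left)
      ((hG.comp cons_meas).comp measurable_prodMk_left)
      ((hH.comp cons_meas).comp measurable_prodMk_left) fun x y => ?_
    refine (hle _ _).trans_eq (congrArg H ?_)
    ext i
    refine Fin.cases ?_ (fun j => ?_) i <;> simp

theorem lintegral_comp_smul_add {n : ℕ} {G : (Fin n → ℝ) → ℝ≥0∞} (hG : Measurable G) {a : ℝ}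
    (ha : 0 < a) (c : Fin n → ℝ) :
    ∫⁻ x, G (a • x + c) = ENNReal.ofReal (a ^ n)⁻¹ * ∫⁻ x, G x := by
  have h := lintegral_map (μ := volume) (hG.comp (measurable_add_const c))
    (measurable_const_smul a : Measurable fun x : Fin n → ℝ => a • x)
  simp only [Function.comp_def] at h
  rw [← h, Measure.map_addHaar_smul _ ha.ne', lintegral_smul_measure,
    lintegral_add_right_eq_self G c]
  simp [abs_of_pos ha]

theorem le_natCast_of_one_add_mul_le_inv_pow {n : ℕ} {K : ℝ}
    (h : ∀ a ∈ Set.Ioo (0 : ℝ) 1, 1 + (1 - a) * K ≤ (a ^ n)⁻¹) : K ≤ n := by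
  by_contra! hK
  have hn : (0 : ℝ) ≤ n := n.cast_nonneg
  have hK₀ : 0 < K := hn.trans_lt hK
  obtain ⟨e, he₀, he₁, he⟩ : ∃ e : ℝ, 0 < e ∧ e < 1 ∧ n * e * K < K - n := by
    refine ⟨(K - n) / ((n + 2) * K), div_pos (by linarith) (by positivity), ?_, ?_⟩
    · rw [div_lt_one (by positivity)]
      nlinarith
    · have : n * ((K - n) / ((n + 2) * K)) * K = n * (K - n) / (n + 2) := by field_simp
      rw [this, div_lt_iff₀ (by positivity)]
      nlinarith
  have h1 := h (1 - e) ⟨by linarith, by linarith⟩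
  have hpos : 0 < (1 - e) ^ n := pow_pos (by linarith) n
  rw [le_inv_comm₀ (by nlinarith) hpos, sub_sub_cancel] at h1
  have h2 : 1 - n * e ≤ (1 - e) ^ n := by
    have := one_add_mul_le_pow (a := -e) (by linarith) n
    rw [← sub_eq_add_neg] at this
    linarith
  have h3 := h2.trans h1
  rw [← one_div, le_div_iff₀ (by nlinarith)] at h3
  nlinarith

/-- Upper Bobkov–Madiman bound: a log-concave density on `ℝⁿ` with maximum density `M` has
differential entropy at most `-log M + n`. -/
theorem entropy_le_of_logConcave {n : ℕ} {G : (Fin n → ℝ) → ℝ≥0∞} (hG : Measurable G)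
    (hG_int : ∫⁻ x, G x = 1)
    (hlc : ∀ a b : ℝ, 0 < a → 0 < b → a + b = 1 → ∀ x y, G x ^ a * G y ^ b ≤ G (a • x + b • y))
    {g : (Fin n → ℝ) → ℝ} (hg : ∀ x, g x = (G x).toReal) {M : ℝ} (hM : 0 < M)
    (hM_ess : essSup (fun x => ENNReal.ofReal (g x)) volume = ENNReal.ofReal M)
    (hint : Integrable fun x => g x * Real.log (g x)) :
    -∫ x, g x * Real.log (g x) ≤ -Real.log M + n := by
  obtain rfl : g = fun x => (G x).toReal := funext hg
  set g := fun x => (G x).toReal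
  have hg₀ (x) : 0 ≤ g x := ENNReal.toReal_nonneg
  have hg_meas : Measurable g := hG.ennreal_toReal
  have hG_ne : ∫⁻ x, G x ≠ ∞ := by simp [hG_int]
  have hg_integrable : Integrable g := integrable_toReal_of_lintegral_ne_top hG.aemeasurable hG_ne
  have hg_int : ∫ x, g x = 1 := by
    rw [integral_toReal hG.aemeasurable (ae_lt_top hG hG_ne), hG_int, ENNReal.toReal_one]
  have bound (m : ℝ) (hm : 0 < m) (hmM : m < M) :
      Real.log m - ∫ x, g x * Real.log (g x) ≤ n := by
    obtain ⟨y, hy⟩ : ∃ y, ENNReal.ofReal m < G y := by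
      by_contra! hle
      refine ((ENNReal.ofReal_lt_ofReal_iff hM).2 hmM).not_ge ?_
      rw [← hM_ess]
      exact essSup_le_of_ae_le _ (.of_forall fun x => ENNReal.ofReal_toReal_le.trans (hle x))
    refine le_natCast_of_one_add_mul_le_inv_pow fun a ⟨ha₀, ha₁⟩ => ?_
    have hb₀ : 0 < 1 - a := sub_pos.2 ha₁
    have hpow : ∫⁻ x, ENNReal.ofReal (g x ^ a * m ^ (1 - a)) ≤ ENNReal.ofReal (a ^ n)⁻¹ := by
      rw [← mul_one (ENNReal.ofReal _), ← hG_int,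
        ← lintegral_comp_smul_add hG ha₀ ((1 - a) • y)]
      refine lintegral_mono fun x => le_trans ?_ (hlc a (1 - a) ha₀ hb₀ (by ring) x y)
      rw [ENNReal.ofReal_mul (Real.rpow_nonneg (hg₀ x) a),
        ← ENNReal.ofReal_rpow_of_nonneg (hg₀ x) ha₀.le,
        ← ENNReal.ofReal_rpow_of_nonneg hm.le hb₀.le]
      gcongr
      exact ENNReal.ofReal_toReal_le
    have hpow₀ (x) : 0 ≤ g x ^ a * m ^ (1 - a) := by have := hg₀ x; positivity
    have hpow_meas : Measurable fun x => g x ^ a * m ^ (1 - a) :=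
      (hg_meas.pow_const a).mul_const _
    have hpow_integrable : Integrable fun x => g x ^ a * m ^ (1 - a) :=
      (lintegral_ofReal_ne_top_iff_integrable hpow_meas.aestronglyMeasurable
        (.of_forall hpow₀)).1 (hpow.trans_lt ENNReal.ofReal_lt_top).ne
    have pointwise (x) : (1 + (1 - a) * Real.log m) * g x - (1 - a) * (g x * Real.log (g x)) ≤
        g x ^ a * m ^ (1 - a) := by
      rcases (hg₀ x).eq_or_lt with h0 | h0
      · simp [← h0, ha₀.ne']
      · have h1 := Real.add_one_le_exp ((1 - a) * (Real.log m - Real.log (g x)))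
        have h2 : g x ^ a * m ^ (1 - a) =
            g x * Real.exp ((1 - a) * (Real.log m - Real.log (g x))) := by
          conv_rhs => enter [1]; rw [← Real.exp_log h0]
          rw [Real.rpow_def_of_pos h0, Real.rpow_def_of_pos hm, ← Real.exp_add, ← Real.exp_add]
          ring_nf
        rw [h2]
        nlinarith
    calc 1 + (1 - a) * (Real.log m - ∫ x, g x * Real.log (g x))
        = ∫ x, ((1 + (1 - a) * Real.log m) * g x - (1 - a) * (g x * Real.log (g x))) := by
          rw [integral_sub (hg_integrable.const_mul _) (hint.const_mul _), integral_const_mul,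
            integral_const_mul, hg_int]
          ring
      _ ≤ ∫ x, g x ^ a * m ^ (1 - a) :=
          integral_mono ((hg_integrable.const_mul _).sub (hint.const_mul _)) hpow_integrable
            pointwise
      _ ≤ (a ^ n)⁻¹ := by
          rw [integral_eq_lintegral_of_nonneg_ae (.of_forall hpow₀)
            hpow_meas.aestronglyMeasurable]
          exact ENNReal.toReal_le_of_le_ofReal (by positivity) hpow
  refine le_of_forall_pos_le_add fun ε hε => ?_
  have h := bound (M * Real.exp (-ε)) (by positivity)
    (mul_lt_of_lt_one_right hM (by simpa using hε))
  rw [Real.log_mul hM.ne' (Real.exp_pos _).ne', Real.log_exp] at h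
  linarith

theorem neg_log_le_entropy {α : Type*} [MeasurableSpace α] {μ : Measure α} {f : α → ℝ}
    (hf_nonneg : ∀ z, 0 ≤ f z) (hf_int : ∫ z, f z ∂μ = 1) {M : ℝ} (hM : 0 < M)
    (hM_ess : essSup (fun z => ENNReal.ofReal (f z)) μ = ENNReal.ofReal M)
    (hint : Integrable (fun z => f z * Real.log (f z)) μ) :
    -Real.log M ≤ -∫ z, f z * Real.log (f z) ∂μ := by
  have hf : Integrable f μ := .of_integral_ne_zero (by simp [hf_int])
  have hle : ∫ z, f z * Real.log (f z) ∂μ ≤ ∫ z, f z * Real.log M ∂μ := by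
    refine integral_mono_ae hint (hf.mul_const _) ?_
    filter_upwards [ENNReal.ae_le_essSup (μ := μ) fun z => ENNReal.ofReal (f z)] with z hz
    rw [hM_ess, ENNReal.ofReal_le_ofReal_iff hM.le] at hz
    rcases (hf_nonneg z).eq_or_lt with h0 | h0
    · simp [← h0]
    · exact mul_le_mul_of_nonneg_left (Real.log_le_log h0 hz) h0.le
  rw [integral_mul_const, hf_int, one_mul] at hle
  exact neg_le_neg hle

/-- The entropy bound for the marginal of a jointly log-concave density. -/
theorem entropy_marginal_le {n k : ℕ} {F : (Fin n → ℝ) → (Fin k → ℝ) → ℝ}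
    (hF : Measurable fun p : (Fin n → ℝ) × (Fin k → ℝ) => F p.1 p.2) (hF₀ : ∀ x u, 0 ≤ F x u)
    (hF_int : ∫⁻ x, ∫⁻ u, ENNReal.ofReal (F x u) = 1)
    (hlc : ∀ a b : ℝ, 0 < a → 0 < b → a + b = 1 → ∀ x y u v,
      F x u ^ a * F y v ^ b ≤ F (a • x + b • y) (a • u + b • v))
    {g : (Fin n → ℝ) → ℝ} (hg : ∀ x, g x = ∫ u, F x u) {M : ℝ} (hM : 0 < M)
    (hM_ess : essSup (fun x => ENNReal.ofReal (g x)) volume = ENNReal.ofReal M)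
    (hint : Integrable fun x => g x * Real.log (g x)) :
    -∫ x, g x * Real.log (g x) ≤ -Real.log M + n := by
  have hF_right (x) : Measurable (F x) := hF.comp measurable_prodMk_left
  refine entropy_le_of_logConcave (G := fun x => ∫⁻ u, ENNReal.ofReal (F x u))
    hF.ennreal_ofReal.lintegral_prod_right' hF_int (fun a b ha hb hab x y => ?_)
    (fun x => ?_) hM hM_ess hint
  · refine prekopaLeindler ha hb hab (hF_right x).ennreal_ofReal (hF_right y).ennreal_ofReal
      (hF_right _).ennreal_ofReal fun u v => ?_
    rw [ENNReal.ofReal_rpow_of_nonneg (hF₀ _ _) ha.le,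
      ENNReal.ofReal_rpow_of_nonneg (hF₀ _ _) hb.le,
      ← ENNReal.ofReal_mul (Real.rpow_nonneg (hF₀ _ _) _)]
    exact ENNReal.ofReal_le_ofReal (hlc a b ha hb hab x y u v)
  · rw [hg, integral_eq_lintegral_of_nonneg_ae (.of_forall (hF₀ x))
      (hF_right x).aestronglyMeasurable]

/-- For a log-concave probability density `f` on
`ℝⁿ = ℝ^{n₁} × ℝ^{n₂}` with marginal densities `f₁, f₂`, finite differential entropies
and finite positive essential suprema `‖f‖_∞ = Mf`, `‖f₁‖_∞ = M1`, `‖f₂‖_∞ = M2`, the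
mutual information satisfies
`h[f₁] + h[f₂] − h[f] ≤ log(‖f‖_∞ / (‖f₁‖_∞ ‖f₂‖_∞)) + n`. -/
theorem stmt12 (n1 n2 : ℕ)
    (f : ((Fin n1 ⊕ Fin n2) → ℝ) → ℝ)
    (hf_meas : Measurable f) (hf_nonneg : ∀ z, 0 ≤ f z)
    (hf_int : ∫ z, f z = 1)
    (hlc : ∀ x y : (Fin n1 ⊕ Fin n2) → ℝ, ∀ l : ℝ, l ∈ Set.Icc (0 : ℝ) 1 →
      f x ^ l * f y ^ (1 - l) ≤ f (l • x + (1 - l) • y))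
    (f1 : (Fin n1 → ℝ) → ℝ) (hf1 : ∀ a, f1 a = ∫ b, f (Sum.elim a b))
    (f2 : (Fin n2 → ℝ) → ℝ) (hf2 : ∀ b, f2 b = ∫ a, f (Sum.elim a b))
    (Mf M1 M2 : ℝ) (hMf : 0 < Mf) (hM1 : 0 < M1) (hM2 : 0 < M2)
    (hMf_ess : essSup (fun z => ENNReal.ofReal (f z)) volume = ENNReal.ofReal Mf)
    (hM1_ess : essSup (fun a => ENNReal.ofReal (f1 a)) volume = ENNReal.ofReal M1)
    (hM2_ess : essSup (fun b => ENNReal.ofReal (f2 b)) volume = ENNReal.ofReal M2)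
    (H H1 H2 : ℝ)
    (hH_int : Integrable (fun z : (Fin n1 ⊕ Fin n2) → ℝ => f z * Real.log (f z)))
    (hH : H = -∫ z, f z * Real.log (f z))
    (hH1_int : Integrable (fun a : Fin n1 → ℝ => f1 a * Real.log (f1 a)))
    (hH1 : H1 = -∫ a, f1 a * Real.log (f1 a))
    (hH2_int : Integrable (fun b : Fin n2 → ℝ => f2 b * Real.log (f2 b)))
    (hH2 : H2 = -∫ b, f2 b * Real.log (f2 b)) :
    H1 + H2 - H ≤ Real.log (Mf / (M1 * M2)) + (n1 + n2 : ℝ) := by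
  have elim_meas :
      Measurable fun p : (Fin n1 → ℝ) × (Fin n2 → ℝ) => (Sum.elim p.1 p.2 : Fin n1 ⊕ Fin n2 → ℝ) :=
    measurable_pi_iff.2 fun
      | .inl i => (measurable_pi_apply i).comp measurable_fst
      | .inr i => (measurable_pi_apply i).comp measurable_snd
  have elim_pres : MeasurePreserving
      (fun p : (Fin n1 → ℝ) × (Fin n2 → ℝ) => (Sum.elim p.1 p.2 : Fin n1 ⊕ Fin n2 → ℝ)) := by
    have h := volume_measurePreserving_sumPiEquivProdPi_symm fun _ : Fin n1 ⊕ Fin n2 => ℝ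
    have heq : (fun p : (Fin n1 → ℝ) × (Fin n2 → ℝ) => (Sum.elim p.1 p.2 : Fin n1 ⊕ Fin n2 → ℝ)) =
        (MeasurableEquiv.sumPiEquivProdPi fun _ : Fin n1 ⊕ Fin n2 => ℝ).symm :=
      funext fun p => funext fun | .inl _ => rfl | .inr _ => rfl
    rw [heq]
    exact h
  have elim_combo (a b : ℝ) (x y : Fin n1 → ℝ) (u v : Fin n2 → ℝ) :
      (Sum.elim (a • x + b • y) (a • u + b • v) : Fin n1 ⊕ Fin n2 → ℝ) =
        a • Sum.elim x u + b • Sum.elim y v := by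
    ext (i | i) <;> rfl
  have hlc' (a b : ℝ) (ha : 0 < a) (hb : 0 < b) (hab : a + b = 1) (x y : Fin n1 → ℝ)
      (u v : Fin n2 → ℝ) : f (Sum.elim x u) ^ a * f (Sum.elim y v) ^ b ≤
        f (Sum.elim (a • x + b • y) (a • u + b • v)) := by
    obtain rfl : b = 1 - a := by linarith
    rw [elim_combo]
    exact hlc _ _ a ⟨ha.le, by linarith⟩
  have hf_elim := hf_meas.comp elim_meas
  have hf_lint : ∫⁻ z, ENNReal.ofReal (f z) = 1 := by
    rw [← ofReal_integral_eq_lintegral_ofReal (.of_integral_ne_zero (by simp [hf_int]))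
      (.of_forall hf_nonneg), hf_int, ENNReal.ofReal_one]
  rw [← elim_pres.lintegral_comp hf_meas.ennreal_ofReal, Measure.volume_eq_prod] at hf_lint
  have hle1 := entropy_marginal_le (F := fun a b => f (Sum.elim a b)) hf_elim
    (fun _ _ => hf_nonneg _)
    ((lintegral_prod _ hf_elim.ennreal_ofReal.aemeasurable).symm.trans hf_lint)
    hlc' hf1 hM1 hM1_ess hH1_int
  have hle2 := entropy_marginal_le (F := fun b a => f (Sum.elim a b))
    (hf_elim.comp measurable_swap) (fun _ _ => hf_nonneg _)
    ((lintegral_prod_symm _ hf_elim.ennreal_ofReal.aemeasurable).symm.trans hf_lint)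
    (fun a b ha hb hab x y u v => hlc' a b ha hb hab u v x y) hf2 hM2 hM2_ess hH2_int
  have hge := neg_log_le_entropy hf_nonneg hf_int hMf hMf_ess hH_int
  rw [← hH1] at hle1
  rw [← hH2] at hle2
  rw [← hH] at hge
  rw [Real.log_div hMf.ne' (mul_pos hM1 hM2).ne', Real.log_mul hM1.ne' hM2.ne']
  linarith
end
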